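/- Let u : ℝ³ → ℝ³ be a smooth compactly supported vector field, ω = ∇∧u its vorticity and φ = ∇·u its expansion rate. Then for every x ∈ ℝ³ the functions y ↦ K₃(y,x) ∧ ω(y) and y ↦ φ(y) K₃(y,x) are integrable on ℝ³, and the Biot–Savart law holds: u(x) = ∫_{ℝ³} K₃(y,x) ∧ ω(y) dy − ∫_{ℝ³} φ(y) K₃(y,x) dy, where K₃(y,x) = (1/(4π)) (y−x)/‖y−x‖³ and ∧ denotes the cross product in ℝ³. -/

import Mathlib

open Real MeasureTheory

noncomputable section

/-- Partial derivative in the `j`-th coordinate direction. -/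
def pd (j : Fin 3) (f : (Fin 3 → ℝ) → ℝ) (x : Fin 3 → ℝ) : ℝ :=
  fderiv ℝ f x (Pi.single j 1)

/-- The Levi-Civita symbol on `Fin 3`. -/
def eps (i j k : Fin 3) : ℝ :=
  (((j : ℕ) : ℝ) - ((i : ℕ) : ℝ)) * (((k : ℕ) : ℝ) - ((i : ℕ) : ℝ)) *
    (((k : ℕ) : ℝ) - ((j : ℕ) : ℝ)) / 2

/-- The vorticity `ω = ∇∧u` of a vector field `u : ℝ³ → ℝ³`. -/
def vort (u : (Fin 3 → ℝ) → Fin 3 → ℝ) (x : Fin 3 → ℝ) : Fin 3 → ℝ :=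
  fun i => ∑ j, ∑ k, eps i j k * pd j (fun y => u y k) x

/-- The expansion rate `φ = ∇·u` of a vector field `u : ℝ³ → ℝ³`. -/
def expRate (u : (Fin 3 → ℝ) → Fin 3 → ℝ) (x : Fin 3 → ℝ) : ℝ :=
  ∑ i, pd i (fun y => u y i) x

/-- The Euclidean norm of a vector in `ℝ³`. -/
def enorm3 (v : Fin 3 → ℝ) : ℝ := Real.sqrt (∑ i, (v i) ^ 2)

/-- The Biot–Savart kernel in `ℝ³`: `K₃(y,x) = (1/(4π)) (y−x)/‖y−x‖³`
(Euclidean norm). -/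
def K3 (y x : Fin 3 → ℝ) : Fin 3 → ℝ :=
  (1 / (4 * π * enorm3 (y - x) ^ 3)) • (y - x)

open Filter Topology Set

def sK (z : Fin 3 → ℝ) : ℝ := Real.sqrt (1 + ∑ i, (z i) ^ 2)

lemma sK_pos (z) : 0 < sK z := Real.sqrt_pos.2 (by positivity)

lemma sK_sq (z) : sK z ^ 2 = 1 + ∑ i, (z i) ^ 2 := Real.sq_sqrt (by positivity)

def FK (i : Fin 3) (z : Fin 3 → ℝ) : ℝ := z i * (1 / (4 * π * sK z ^ 3))

def DK (z : Fin 3 → ℝ) : ℝ := 3 / (4 * π * sK z ^ 5)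

lemma sK_contDiff : ContDiff ℝ 1 sK := by
  unfold sK
  apply ContDiff.sqrt
  · fun_prop
  · intro x; positivity

lemma FK_contDiff (i) : ContDiff ℝ 1 (FK i) := by
  unfold FK
  apply ContDiff.mul (by fun_prop)
  apply ContDiff.div contDiff_const
  · exact contDiff_const.mul (sK_contDiff.pow 3)
  · intro x; have := sK_pos x; positivity

lemma pd_sK (j) (z) : fderiv ℝ sK z (Pi.single j 1) = z j / sK z := by
  have h1 : HasFDerivAt (fun z : Fin 3 → ℝ => 1 + ∑ i, (z i) ^ 2)
      (∑ i, (2 * z i) • (ContinuousLinearMap.proj i : (Fin 3 → ℝ) →L[ℝ] ℝ)) z := by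
    apply HasFDerivAt.const_add
    apply HasFDerivAt.fun_sum
    intro i _
    have := (hasFDerivAt_apply (𝕜 := ℝ) i z).pow 2
    simpa using this
  have h2 := h1.sqrt (by positivity)
  rw [show sK = fun z => Real.sqrt (1 + ∑ i, (z i) ^ 2) from rfl, h2.fderiv]
  simp [Pi.single_apply]
  field_simp

lemma pd_FK (i j) (z) : pd j (FK i) z =
    ((if i = j then 1 else 0) / sK z ^ 3 - 3 * z i * z j / sK z ^ 5) / (4 * π) := by
  have hs := sK_pos z
  have h1 : HasFDerivAt sK (fderiv ℝ sK z) z :=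
    (sK_contDiff.differentiable one_ne_zero z).hasFDerivAt
  have h2 : HasDerivAt (fun r : ℝ => 1 / (4 * π * r ^ 3)) (-3 / (4 * π * sK z ^ 4)) (sK z) := by
    have h := (((hasDerivAt_pow 3 (sK z)).const_mul (4 * π)).fun_inv (by positivity))
    simp only [one_div]
    refine h.congr_deriv ?_
    field_simp
    norm_num
    ring
  have h3 := (hasFDerivAt_apply (𝕜 := ℝ) i z).mul (h2.comp_hasFDerivAt z h1)
  have h4 : HasFDerivAt (FK i) _ z := h3
  rw [pd, h4.fderiv]
  simp only [add_apply, smul_apply, pd_sK]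
  simp [Pi.single_apply]
  split_ifs <;> field_simp <;> ring

lemma pd_FK_symm (i j) (z) : pd j (FK i) z = pd i (FK j) z := by
  rw [pd_FK, pd_FK]
  simp only [eq_comm (a := i)]
  ring

lemma div_FK (z) : ∑ j, pd j (FK j) z = DK z := by
  have hs := sK_pos z
  have h := sK_sq z
  simp only [pd_FK, Fin.sum_univ_three, DK] at *
  field_simp
  simp
  nlinarith

lemma norm_le_e (z : Fin 3 → ℝ) : ‖z‖ ^ 2 ≤ ∑ i, (z i) ^ 2 := by
  have h : ‖z‖ ≤ Real.sqrt (∑ i, (z i) ^ 2) := by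
    rw [pi_norm_le_iff_of_nonneg (Real.sqrt_nonneg _)]
    intro i
    apply Real.le_sqrt_of_sq_le
    rw [Real.norm_eq_abs, sq_abs]
    exact Finset.single_le_sum (f := fun i => (z i) ^ 2) (fun i _ => sq_nonneg _) (Finset.mem_univ i)
  calc _ ≤ (Real.sqrt (∑ i, (z i) ^ 2)) ^ 2 := by gcongr
    _ = _ := Real.sq_sqrt (by positivity)

lemma norm_le_sK (z) : ‖z‖ ≤ sK z := by
  apply Real.le_sqrt_of_sq_le
  linarith [norm_le_e z]

/-- common bound -/
lemma kbound {z : Fin 3 → ℝ} {s : ℝ} (h : ‖z‖ ≤ s) (i : Fin 3) :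
    |z i * (1 / (4 * π * s ^ 3))| ≤ (‖z‖ ^ 2)⁻¹ := by
  have hi : |z i| ≤ ‖z‖ := norm_le_pi_norm z i
  rcases (norm_nonneg z).eq_or_lt with h0 | h0
  · have : z i = 0 := by rw [← h0] at hi; exact abs_nonpos_iff.1 hi
    simp [this]
  · rw [abs_mul, abs_of_nonneg (a := 1 / (4 * π * s ^ 3)) (by have := h0.le.trans h; positivity)]
    have hpi := Real.pi_gt_three
    have hs : 0 < s := h0.trans_le h
    have h4 : 1 ≤ 4 * π := by linarith
    calc |z i| * (1 / (4 * π * s ^ 3)) ≤ ‖z‖ * (1 / (1 * ‖z‖ ^ 3)) := by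
          gcongr
      _ = _ := by field_simp

lemma integral_DK : ∫ z, DK z = 1 := by
  have h1 : ∫ z, DK z = ∫ w : EuclideanSpace ℝ (Fin 3),
      (fun r : ℝ => 3 / (4 * π * Real.sqrt (1 + r ^ 2) ^ 5)) ‖w‖ := by
    rw [← (PiLp.volume_preserving_toLp (Fin 3)).integral_comp
      (MeasurableEquiv.toLp 2 _).measurableEmbedding]
    congr 1
    ext z
    simp only [EuclideanSpace.norm_eq, DK, sK]
    rw [Real.sq_sqrt (by positivity)]
    simp
  rw [h1, integral_fun_norm_addHaar volume
    (fun r : ℝ => 3 / (4 * π * Real.sqrt (1 + r ^ 2) ^ 5))]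
  have hb : (volume : Measure (EuclideanSpace ℝ (Fin 3))).real (Metric.ball 0 1) = π * 4 / 3 := by
    rw [Measure.real, EuclideanSpace.volume_ball_fin_three]
    simp
    positivity
  rw [hb]
  have h2 : ∫ r in Ioi (0:ℝ), 3 * r ^ 2 / Real.sqrt (1 + r ^ 2) ^ 5
      = 1 - (0 / Real.sqrt (1 + 0 ^ 2)) ^ 3 := by
    apply integral_Ioi_of_hasDerivAt_of_nonneg'
      (g := fun r : ℝ => (r / Real.sqrt (1 + r ^ 2)) ^ 3)
    · intro r _
      have hp : 0 < 1 + r ^ 2 := by positivity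
      have hs := Real.sqrt_pos.2 hp
      have hq := Real.sq_sqrt hp.le
      have a := (((hasDerivAt_pow 2 r).const_add 1).sqrt hp.ne')
      have b := ((hasDerivAt_id r).fun_div a hs.ne').fun_pow 3
      refine b.congr_deriv ?_
      have h9 : (r / √(1 + r ^ 2)) ^ 2 * (1 + r ^ 2) = r ^ 2 := by
        rw [div_pow, hq]; field_simp
      field_simp
      rw [hq]
      norm_num
      linear_combination 6 * h9
    · intro r _; positivity
    · have : Tendsto (fun r : ℝ => (1 / Real.sqrt (1 / r ^ 2 + 1)) ^ 3) atTop
          (𝓝 ((1 / Real.sqrt (0 + 1)) ^ 3)) := by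
        have h0 : Tendsto (fun r : ℝ => 1 / r ^ 2) atTop (𝓝 0) := by
          simpa using tendsto_pow_neg_atTop (𝕜 := ℝ) (n := 2) two_ne_zero
        exact (tendsto_const_nhds.div ((h0.add_const 1).sqrt) (by simp)).pow 3
      simp only [zero_add, Real.sqrt_one, div_one, one_pow] at this
      refine this.congr' ?_
      filter_upwards [eventually_gt_atTop 0] with r hr
      congr 1
      have : 1 + r ^ 2 = r ^ 2 * (1 / r ^ 2 + 1) := by field_simp
      rw [this, Real.sqrt_mul (by positivity), Real.sqrt_sq hr.le]
      field_simp
  have h3 : ∫ r in Ioi (0:ℝ), r ^ (Module.finrank ℝ (EuclideanSpace ℝ (Fin 3)) - 1) •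
      (3 / (4 * π * Real.sqrt (1 + r ^ 2) ^ 5)) = 1 / (4 * π) := by
    rw [show 1 / (4 * π) = (1 / (4 * π)) * (1 - (0 / Real.sqrt (1 + 0 ^ 2)) ^ 3) by simp, ← h2,
      ← integral_const_mul]
    congr 1
    ext r
    simp
    field_simp
  rw [h3]
  simp
  field_simp

lemma DK_decay : Tendsto (fun z : Fin 3 → ℝ => ‖z‖ ^ Module.finrank ℝ (Fin 3 → ℝ) * DK z)
    (Bornology.cobounded _) (𝓝 0) := by
  have h0 : Tendsto (fun r : ℝ => 1 / r ^ 2) atTop (𝓝 0) := by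
    simpa using tendsto_pow_neg_atTop (𝕜 := ℝ) (n := 2) two_ne_zero
  have h1 := h0.comp (tendsto_norm_cobounded_atTop (E := Fin 3 → ℝ))
  refine squeeze_zero' (Eventually.of_forall fun z => ?_) ?_ h1
  · have := sK_pos z; unfold DK; positivity
  · filter_upwards [tendsto_norm_cobounded_atTop.eventually_gt_atTop 0] with z hz
    have := sK_pos z
    have hpi := Real.pi_gt_three
    simp only [DK, Function.comp, Module.finrank_fin_fun]
    calc ‖z‖ ^ 3 * (3 / (4 * π * sK z ^ 5)) ≤ ‖z‖ ^ 3 * (3 / (3 * ‖z‖ ^ 5)) := by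
          have := norm_le_sK z
          gcongr; linarith
      _ = _ := by field_simp

lemma inv_sq_locInt : LocallyIntegrable (fun z : Fin 3 → ℝ => (‖z‖ ^ 2)⁻¹) volume := by
  refine locallyIntegrable_of_norm_le_rpow (C := 1) (α := 2) ?_ ?_ ?_ ?_
  · simp
  · simp; norm_num
  · refine Eventually.of_forall fun z => ?_
    rw [Real.rpow_neg (norm_nonneg _)]
    simp
  · exact (by fun_prop : Measurable (fun z : Fin 3 → ℝ => (‖z‖ ^ 2)⁻¹)).aestronglyMeasurable

lemma dom_int (f : (Fin 3 → ℝ) → ℝ) (hf : Continuous f) (hs : HasCompactSupport f)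
    (x : Fin 3 → ℝ) : Integrable (fun y => (‖y - x‖ ^ 2)⁻¹ * |f y|) := by
  have h1 : Continuous (fun z => |f (z + x)|) := by fun_prop
  have h2 : HasCompactSupport (fun z => |f (z + x)|) := by
    have := (hs.comp_homeomorph (Homeomorph.addRight x)).comp_left (g := fun r : ℝ => |r|) (by simp)
    exact this
  have h3 := inv_sq_locInt.integrable_smul_right_of_hasCompactSupport h1 h2
  have h4 := h3.comp_sub_right x
  simpa using h4

lemma K3_eq (y x : Fin 3 → ℝ) (i) :
    K3 y x i = (y - x) i * (1 / (4 * π * enorm3 (y - x) ^ 3)) := by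
  simp only [K3, Pi.smul_apply, smul_eq_mul]; ring

lemma norm_le_enorm3 (z : Fin 3 → ℝ) : ‖z‖ ≤ enorm3 z := Real.le_sqrt_of_sq_le (norm_le_e z)

lemma K3_bound (y x : Fin 3 → ℝ) (i) : |K3 y x i| ≤ (‖y - x‖ ^ 2)⁻¹ := by
  rw [K3_eq]; exact kbound (norm_le_enorm3 _) i

/-- regularized kernel -/
def KR (c : ℝ) (x : Fin 3 → ℝ) (i : Fin 3) (y : Fin 3 → ℝ) : ℝ := c ^ 2 * FK i (c • (y - x))

lemma KR_bound {c : ℝ} (hc : 0 < c) (y x : Fin 3 → ℝ) (i) :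
    |KR c x i y| ≤ (‖y - x‖ ^ 2)⁻¹ := by
  have h := kbound (norm_le_sK (c • (y - x))) i
  rw [norm_smul, Real.norm_of_nonneg hc.le] at h
  rw [KR, abs_mul, abs_of_pos (by positivity : 0 < c ^ 2)]
  calc _ ≤ c ^ 2 * ((c * ‖y - x‖) ^ 2)⁻¹ := by gcongr; exact h
    _ = _ := by rw [mul_pow, mul_inv]; field_simp

lemma KR_contDiff (c x i) : ContDiff ℝ 1 (KR c x i) := by
  unfold KR
  exact contDiff_const.mul ((FK_contDiff i).comp (by fun_prop))

lemma pd_KR (c x i j y) : pd j (KR c x i) y = c ^ 3 * pd j (FK i) (c • (y - x)) := by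
  have h1 : HasFDerivAt (FK i) (fderiv ℝ (FK i) (c • (y - x))) (c • (y - x)) :=
    ((FK_contDiff i).differentiable one_ne_zero _).hasFDerivAt
  have h2 : HasFDerivAt (fun y : Fin 3 → ℝ => c • (y - x))
      (c • ContinuousLinearMap.id ℝ (Fin 3 → ℝ)) y :=
    ((hasFDerivAt_id y).sub_const x).const_smul c
  have h3 : HasFDerivAt (KR c x i) _ y := (h1.comp y h2).const_mul (c ^ 2)
  rw [pd, h3.fderiv]
  simp [pd]
  ring

lemma KR_tendsto (x i y) : Tendsto (fun c => KR c x i y) atTop (𝓝 (K3 y x i)) := by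
  rw [K3_eq]
  set z := y - x with hz
  rcases eq_or_ne z 0 with h0 | h0
  · simp only [KR, ← hz, h0]
    simp [FK]
  have hpos : 0 < ∑ i, (z i) ^ 2 :=
    lt_of_lt_of_le (by have := norm_pos_iff.2 h0; positivity) (norm_le_e z)
  have hq : Tendsto (fun r : ℝ => 1 / r ^ 2) atTop (𝓝 0) := by
    simpa using tendsto_pow_neg_atTop (𝕜 := ℝ) (n := 2) two_ne_zero
  have ha : Tendsto (fun c : ℝ => z i * (1 / (4 * π * Real.sqrt (1 / c ^ 2 + ∑ i, (z i) ^ 2) ^ 3)))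
      atTop (𝓝 (z i * (1 / (4 * π * Real.sqrt (0 + ∑ i, (z i) ^ 2) ^ 3)))) := by
    refine Tendsto.const_mul _ (tendsto_const_nhds.div
      ((((hq.add_const _).sqrt).pow 3).const_mul _) ?_)
    have : 0 < Real.sqrt (0 + ∑ i, (z i) ^ 2) := Real.sqrt_pos.2 (by simpa using hpos)
    positivity
  rw [zero_add] at ha
  refine ha.congr' ?_
  filter_upwards [eventually_gt_atTop 0] with c hc
  have h1 : sK (c • z) = c * Real.sqrt (1 / c ^ 2 + ∑ i, (z i) ^ 2) := by
    rw [← Real.sqrt_sq hc.le, ← Real.sqrt_mul (by positivity), Real.sqrt_sq hc.le, sK]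
    congr 1
    simp only [Pi.smul_apply, smul_eq_mul, mul_pow, ← Finset.mul_sum]
    field_simp
  have h2 : 0 < Real.sqrt (1 / c ^ 2 + ∑ i, (z i) ^ 2) := Real.sqrt_pos.2 (by positivity)
  simp only [KR, FK, ← hz, h1, Pi.smul_apply, smul_eq_mul]
  field_simp

lemma K3_meas (x i) : Measurable (fun y => K3 y x i) := by
  simp only [K3_eq, enorm3]
  fun_prop

lemma K3_int (f : (Fin 3 → ℝ) → ℝ) (hf : Continuous f) (hs : HasCompactSupport f)
    (x : Fin 3 → ℝ) (i) : Integrable (fun y => K3 y x i * f y) := by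
  refine (dom_int f hf hs x).mono' ((K3_meas x i).mul hf.measurable).aestronglyMeasurable ?_
  refine Eventually.of_forall fun y => ?_
  rw [Real.norm_eq_abs, abs_mul]
  have := K3_bound y x i
  gcongr

lemma KR_int_tendsto (f : (Fin 3 → ℝ) → ℝ) (hf : Continuous f) (hs : HasCompactSupport f)
    (x : Fin 3 → ℝ) (i) : Tendsto (fun c => ∫ y, KR c x i y * f y) atTop
      (𝓝 (∫ y, K3 y x i * f y)) := by
  refine tendsto_integral_filter_of_dominated_convergence _ ?_ ?_ (dom_int f hf hs x) ?_
  · exact Eventually.of_forall fun c =>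
      (((KR_contDiff c x i).continuous).mul hf).aestronglyMeasurable
  · filter_upwards [eventually_gt_atTop 0] with c hc
    refine Eventually.of_forall fun y => ?_
    rw [Real.norm_eq_abs, abs_mul]
    have := KR_bound hc y x i
    gcongr
  · exact Eventually.of_forall fun y => (KR_tendsto x i y).mul_const _

lemma ibp (g f : (Fin 3 → ℝ) → ℝ) (hg : ContDiff ℝ 1 g) (hf : ContDiff ℝ 1 f)
    (hs : HasCompactSupport f) (j) : ∫ y, g y * pd j f y = - ∫ y, pd j g y * f y := by
  have cg : Continuous (pd j g) := (hg.continuous_fderiv one_ne_zero).clm_apply continuous_const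
  have cf : Continuous (pd j f) := (hf.continuous_fderiv one_ne_zero).clm_apply continuous_const
  have sf : HasCompactSupport (pd j f) := hs.fderiv_apply ℝ _
  apply integral_mul_fderiv_eq_neg_fderiv_mul_of_integrable
  · exact (cg.mul hf.continuous).integrable_of_hasCompactSupport hs.mul_left
  · exact (hg.continuous.mul cf).integrable_of_hasCompactSupport sf.mul_left
  · exact (hg.continuous.mul hf.continuous).integrable_of_hasCompactSupport hs.mul_left
  · intro y _; exact hg.differentiable one_ne_zero y
  · intro y _; exact hf.differentiable one_ne_zero y

lemma DK_tendsto (f : (Fin 3 → ℝ) → ℝ) (hf : Continuous f) (hs : HasCompactSupport f)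
    (x : Fin 3 → ℝ) : Tendsto (fun c : ℝ => ∫ y, (c ^ 3 * DK (c • (y - x))) * f y) atTop
      (𝓝 (f x)) := by
  have hn : ∀ z, 0 ≤ DK z := fun z => by have := sK_pos z; unfold DK; positivity
  have h := tendsto_integral_comp_smul_smul_of_integrable (μ := volume) hn integral_DK DK_decay
    (g := fun z => f (z + x)) ((hf.integrable_of_hasCompactSupport hs).comp_add_right x)
    (by fun_prop)
  simp only [zero_add, Module.finrank_fin_fun, smul_eq_mul] at h
  refine h.congr fun c => ?_
  rw [← integral_sub_right_eq_self _ x]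
  simp

lemma KR_identity (v : Fin 3 → (Fin 3 → ℝ) → ℝ) (hv : ∀ k, ContDiff ℝ 1 (v k))
    (hs : ∀ k, HasCompactSupport (v k)) (x : Fin 3 → ℝ) (c : ℝ) (i : Fin 3) :
    ∑ j, ((∫ y, KR c x j y * pd i (v j) y) - (∫ y, KR c x j y * pd j (v i) y)
      - ∫ y, KR c x i y * pd j (v j) y) = ∫ y, (c ^ 3 * DK (c • (y - x))) * v i y := by
  have e : ∀ a b k, ∫ y, KR c x a y * pd b (v k) y = - ∫ y, pd b (KR c x a) y * v k y :=
    fun a b k => ibp _ _ (KR_contDiff c x a) (hv k) (hs k) b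
  have sy : ∀ a b, pd b (KR c x a) = pd a (KR c x b) := fun a b => by
    ext y; rw [pd_KR, pd_KR, pd_FK_symm]
  have hD : ∀ y, (c ^ 3 * DK (c • (y - x))) * v i y = ∑ j, pd j (KR c x j) y * v i y := by
    intro y
    simp only [pd_KR, ← div_FK, Finset.mul_sum, Finset.sum_mul]
  simp only [hD]
  rw [integral_finsetSum]
  · refine Finset.sum_congr rfl fun j _ => ?_
    rw [e, e, e, sy i j]; ring
  · intro j _
    have cg : Continuous (pd j (KR c x j)) :=
      ((KR_contDiff c x j).continuous_fderiv one_ne_zero).clm_apply continuous_const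
    exact (cg.mul (hv i).continuous).integrable_of_hasCompactSupport (hs i).mul_left

lemma scalar_law (v : Fin 3 → (Fin 3 → ℝ) → ℝ) (hv : ∀ k, ContDiff ℝ 1 (v k))
    (hs : ∀ k, HasCompactSupport (v k)) (x : Fin 3 → ℝ) (i : Fin 3) :
    v i x = ∑ j, ((∫ y, K3 y x j * pd i (v j) y) - (∫ y, K3 y x j * pd j (v i) y)
      - ∫ y, K3 y x i * pd j (v j) y) := by
  have t : ∀ a b k, Tendsto (fun c => ∫ y, KR c x a y * pd b (v k) y) atTop
      (𝓝 (∫ y, K3 y x a * pd b (v k) y)) := fun a b k =>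
    KR_int_tendsto _ (((hv k).continuous_fderiv one_ne_zero).clm_apply continuous_const)
      ((hs k).fderiv_apply ℝ _) x a
  refine tendsto_nhds_unique (DK_tendsto (v i) (hv i).continuous (hs i) x) ?_
  simp only [← KR_identity v hv hs]
  exact tendsto_finsetSum _ fun j _ => ((t j i j).sub (t j j i)).sub (t i j j)

/-- Biot–Savart law: for a smooth compactly supported `u : ℝ³ → ℝ³` with vorticity
`ω = ∇∧u` and expansion rate `φ = ∇·u`, the integrands `y ↦ K₃(y,x) ∧ ω(y)` and
`y ↦ φ(y) K₃(y,x)` are integrable and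
`u(x) = ∫ K₃(y,x) ∧ ω(y) dy − ∫ φ(y) K₃(y,x) dy`. -/
theorem statement_4 (u : (Fin 3 → ℝ) → Fin 3 → ℝ) (hu : ContDiff ℝ (⊤ : ℕ∞) u)
    (hsupp : HasCompactSupport u) (x : Fin 3 → ℝ) :
    Integrable (fun y => crossProduct (K3 y x) (vort u y)) ∧
    Integrable (fun y => expRate u y • K3 y x) ∧
    u x = (∫ y, crossProduct (K3 y x) (vort u y)) - ∫ y, expRate u y • K3 y x := by
  have hv : ∀ k, ContDiff ℝ 1 (fun y => u y k) := fun k =>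
    (contDiff_pi.1 hu k).of_le (by exact_mod_cast le_top)
  have hs : ∀ k, HasCompactSupport (fun y => u y k) := fun k =>
    hsupp.comp_left (g := fun w : Fin 3 → ℝ => w k) rfl
  have I : ∀ a b k, Integrable (fun y => K3 y x a * pd b (fun y => u y k) y) := fun a b k =>
    K3_int _ (((hv k).continuous_fderiv one_ne_zero).clm_apply continuous_const)
      ((hs k).fderiv_apply ℝ _) x a
  have eA : ∀ y i, crossProduct (K3 y x) (vort u y) i =
      ∑ j, (K3 y x j * pd i (fun y => u y j) y - K3 y x j * pd j (fun y => u y i) y) := by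
    intro y i
    fin_cases i <;> simp [cross_apply, vort, eps, Fin.sum_univ_three] <;> ring
  have eB : ∀ y i, (expRate u y • K3 y x) i = ∑ j, K3 y x i * pd j (fun y => u y j) y := by
    intro y i
    simp only [expRate, Pi.smul_apply, smul_eq_mul, Finset.sum_mul]
    exact Finset.sum_congr rfl fun j _ => mul_comm _ _
  have iA : ∀ i, Integrable (fun y => crossProduct (K3 y x) (vort u y) i) := by
    intro i
    simp only [eA]
    exact integrable_finsetSum _ fun j _ => (I j i j).sub (I j j i)
  have iB : ∀ i, Integrable (fun y => (expRate u y • K3 y x) i) := by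
    intro i
    simp only [eB]
    exact integrable_finsetSum _ fun j _ => I i j j
  refine ⟨Integrable.of_eval iA, Integrable.of_eval iB, ?_⟩
  ext i
  rw [Pi.sub_apply, eval_integral iA, eval_integral iB]
  simp only [eA, eB]
  have J : ∀ j, Integrable (fun y => K3 y x j * pd i (fun y => u y j) y
      - K3 y x j * pd j (fun y => u y i) y) := fun j => (I j i j).sub (I j j i)
  rw [integral_finsetSum _ fun j _ => J j,
    integral_finsetSum _ fun j _ => I i j j, ← Finset.sum_sub_distrib]
  rw [scalar_law (fun k y => u y k) hv hs x i]
  refine Finset.sum_congr rfl fun j _ => ?_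
  rw [integral_sub (I j i j) (I j j i)]
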